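/- Let n be a nonnegative integer and a, b, c, p, w ∈ ℂ. Assume bc − p(a−p) ≠ 0 and set γ = p(a−p)(b+c−a)/(bc − p(a−p)). Assume the parameters are nondegenerate for the identity below. Then ₆F₅(a, b, c, a−p+1, p+1, −n; 1+a−b, 1+a−c, p, a−p, w; 1) = ((w−a)_n / (w)_n) · ₆F₅(1+a−w, a/2, (a+1)/2, a−b−c, γ+1, −n; 1+a−b, 1+a−c, (1+a−w−n)/2, (2+a−w−n)/2, γ; 1). -/

import Mathlib

/-- Rising factorial (Pochhammer symbol) `(a)ₖ = a(a+1)⋯(a+k−1)`. -/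
noncomputable def poch (a : ℂ) (k : ℕ) : ℂ := (ascPochhammer ℂ k).eval a

/-- Terminating hypergeometric sum with numerator parameters `A` together with
the extra top parameter `-n`, denominator parameters `B`, and argument `x`. -/
noncomputable def hypTerm (A B : List ℂ) (n : ℕ) (x : ℂ) : ℂ :=
  ∑ k ∈ Finset.range (n + 1),
    ((A.map fun a => poch a k).prod * poch (-(n : ℂ)) k) /
      ((k.factorial : ℂ) * (B.map fun b => poch b k).prod) * x ^ k

open Finset

theorem poch_zero (x : ℂ) : poch x 0 = 1 := by simp [poch]

theorem poch_succ (x : ℂ) (k : ℕ) : poch x (k + 1) = poch x k * (x + k) :=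
  ascPochhammer_succ_eval k x

theorem poch_add (x : ℂ) (m k : ℕ) : poch x (m + k) = poch x m * poch (x + m) k := by
  induction k with
  | zero => simp [poch_zero]
  | succ k ih => rw [← add_assoc, poch_succ, ih, poch_succ]; push_cast; ring

theorem poch_succ' (x : ℂ) (k : ℕ) : poch x (k + 1) = x * poch (x + 1) k := by
  rw [add_comm k, poch_add, poch_succ, poch_zero]; simp

theorem poch_ne_zero_of_le {x : ℂ} {m k : ℕ} (h : m ≤ k) (hk : poch x k ≠ 0) :
    poch x m ≠ 0 := by
  obtain ⟨i, rfl⟩ := Nat.exists_eq_add_of_le h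
  rw [poch_add] at hk
  exact left_ne_zero_of_mul hk

theorem poch_neg_natCast (n k : ℕ) :
    poch (-(n : ℂ)) k = (-1) ^ k * k.factorial * n.choose k := by
  induction k with
  | zero => simp [poch_zero]
  | succ k ih =>
    have h := Nat.choose_succ_right_eq n k
    rw [poch_succ, ih, Nat.factorial_succ]
    rcases le_or_gt k n with hk | hk
    · have h' : (n.choose (k + 1) : ℂ) * (k + 1) = n.choose k * (n - k) := by
        rw [← Nat.cast_sub hk]; exact_mod_cast h
      push_cast
      linear_combination (-1) ^ k * (k.factorial : ℂ) * h'
    · simp [Nat.choose_eq_zero_of_lt hk, Nat.choose_eq_zero_of_lt (Nat.lt_succ_of_lt hk)]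

/-- The duplication formula. -/
theorem poch_two_mul (x : ℂ) (k : ℕ) :
    poch x (2 * k) = 4 ^ k * (poch (x / 2) k * poch ((x + 1) / 2) k) := by
  induction k with
  | zero => simp [poch_zero]
  | succ k ih =>
    rw [show 2 * (k + 1) = 2 * k + 1 + 1 by ring]
    simp only [poch_succ, ih]
    push_cast
    ring

/-- The reflection formula. -/
theorem poch_reflect (x : ℂ) (k : ℕ) : poch (x - k) k = (-1) ^ k * poch (1 - x) k := by
  induction k generalizing x with
  | zero => simp [poch_zero]
  | succ k ih =>
    have h := ih (x - 1)
    rw [show x - 1 - (k : ℂ) = x - (k + 1 : ℕ) by push_cast; ring] at h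
    rw [poch_succ, h, poch_succ']
    push_cast
    rw [show 1 - (x - 1) = 1 - x + 1 by ring]
    ring

theorem cast_choose_succ_mul (k m : ℕ) :
    (k.choose (m + 1) : ℂ) = k.choose m * (k - m) / (m + 1) := by
  have hm : (m : ℂ) + 1 ≠ 0 := Nat.cast_add_one_ne_zero m
  rw [eq_div_iff hm]
  rcases le_or_gt m k with h | h
  · rw [← Nat.cast_sub h]; exact_mod_cast Nat.choose_succ_right_eq k m
  · simp [Nat.choose_eq_zero_of_lt h, Nat.choose_eq_zero_of_lt (Nat.lt_succ_of_lt h)]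

/-- The Chu–Vandermonde sum. -/
theorem sum_choose_poch_div (x w : ℂ) (n : ℕ) (hw : poch w n ≠ 0) :
    ∑ i ∈ range (n + 1), (-1) ^ i * (n.choose i : ℂ) * poch x i / poch w i
      = poch (w - x) n / poch w n := by
  induction n with
  | zero => simp [poch_zero]
  | succ n ih =>
    have hn := poch_ne_zero_of_le n.le_succ hw
    have hwn : w + n ≠ 0 := by rw [poch_succ] at hw; exact right_ne_zero_of_mul hw
    have telescope : ∀ m ≤ n + 1, ∑ i ∈ range (m + 1),
        ((w + n) * ((-1) ^ i * ((n + 1).choose i : ℂ) * poch x i / poch w i)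
          - (w - x + n) * ((-1) ^ i * (n.choose i : ℂ) * poch x i / poch w i))
        = (-1) ^ m * (n.choose m : ℂ) * poch x (m + 1) / poch w m := by
      intro m hm
      induction m with
      | zero => simp [poch_zero, poch_succ]
      | succ m ihm =>
        have h1 := poch_ne_zero_of_le hm hw
        rw [sum_range_succ, ihm (by omega), Nat.choose_succ_succ]
        push_cast
        rw [cast_choose_succ_mul]
        simp only [poch_succ] at h1 ⊢
        have h2 := left_ne_zero_of_mul h1
        have h3 := right_ne_zero_of_mul h1
        have hm' : (m : ℂ) + 1 ≠ 0 := Nat.cast_add_one_ne_zero m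
        push_cast
        field_simp
        ring
    have h := telescope (n + 1) le_rfl
    rw [sum_sub_distrib, ← mul_sum, ← mul_sum, sum_range_succ (fun i =>
      (-1) ^ i * (n.choose i : ℂ) * poch x i / poch w i) (n + 1),
      Nat.choose_succ_self, ih hn] at h
    rw [poch_succ (w - x), poch_succ w n, eq_div_iff (mul_ne_zero hn hwn)]
    simp only [Nat.cast_zero, mul_zero, zero_mul, zero_div, add_zero] at h
    field_simp at h
    linear_combination h

/-- The Pfaff–Saalschütz sum, in a form symmetric in `b` and `c`. -/
theorem sum_saalschuetz (a b c : ℂ) (n : ℕ) (hu : poch (1 + a - b) n ≠ 0)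
    (hv : poch (1 + a - c) n ≠ 0) :
    ∑ j ∈ range (n + 1), (-1) ^ j * (n.choose j : ℂ) * poch (a + n) j * poch (1 + a - b - c) j
        / (poch (1 + a - b) j * poch (1 + a - c) j)
      = poch b n * poch c n / (poch (1 + a - b) n * poch (1 + a - c) n) := by
  induction n with
  | zero => simp [poch_zero]
  | succ n ih =>
    have hun := poch_ne_zero_of_le n.le_succ hu
    have hvn := poch_ne_zero_of_le n.le_succ hv
    have hun' : 1 + a - b + n ≠ 0 := by rw [poch_succ] at hu; exact right_ne_zero_of_mul hu
    have hvn' : 1 + a - c + n ≠ 0 := by rw [poch_succ] at hv; exact right_ne_zero_of_mul hv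
    have telescope : ∀ m ≤ n + 1, ∑ j ∈ range (m + 1),
        ((1 + a - b + n) * (1 + a - c + n) * ((-1) ^ j * ((n + 1).choose j : ℂ)
            * poch (a + (n + 1 : ℕ)) j * poch (1 + a - b - c) j
            / (poch (1 + a - b) j * poch (1 + a - c) j))
          - (b + n) * (c + n) * ((-1) ^ j * (n.choose j : ℂ)
            * poch (a + n) j * poch (1 + a - b - c) j
            / (poch (1 + a - b) j * poch (1 + a - c) j)))
        = (1 + a + 2 * n) * ((-1) ^ m * (n.choose m : ℂ) * poch (a + n + 1) m
            * poch (1 + a - b - c) (m + 1) / (poch (1 + a - b) m * poch (1 + a - c) m)) := by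
      intro m hm
      induction m with
      | zero => simp [poch_zero, poch_succ]; ring
      | succ m ihm =>
        have h1 := poch_ne_zero_of_le hm hu
        have h1' := poch_ne_zero_of_le hm hv
        rw [sum_range_succ, ihm (by omega), Nat.choose_succ_succ, poch_succ' (a + n) m,
          show a + ((n + 1 : ℕ) : ℂ) = a + n + 1 by push_cast; ring]
        push_cast
        rw [cast_choose_succ_mul]
        simp only [poch_succ] at h1 h1' ⊢
        have h2 := left_ne_zero_of_mul h1
        have h3 := right_ne_zero_of_mul h1
        have h2' := left_ne_zero_of_mul h1'
        have h3' := right_ne_zero_of_mul h1'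
        have hm' : (m : ℂ) + 1 ≠ 0 := Nat.cast_add_one_ne_zero m
        push_cast
        field_simp
        ring
    have h := telescope (n + 1) le_rfl
    rw [sum_sub_distrib, ← mul_sum, ← mul_sum, sum_range_succ (fun j => (-1) ^ j
        * (n.choose j : ℂ) * poch (a + n) j * poch (1 + a - b - c) j
        / (poch (1 + a - b) j * poch (1 + a - c) j)) (n + 1),
      Nat.choose_succ_self, ih hun hvn] at h
    rw [poch_succ b, poch_succ c, poch_succ (1 + a - b) n, poch_succ (1 + a - c) n,
      eq_div_iff (mul_ne_zero (mul_ne_zero hun hun') (mul_ne_zero hvn hvn'))]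
    simp only [Nat.cast_zero, mul_zero, zero_mul, zero_div, add_zero] at h
    field_simp at h
    linear_combination h

/-- The contiguous form of the Pfaff–Saalschütz sum obtained by inserting a linear factor. -/
theorem sum_saalschuetz_linear (a b c s q : ℂ) (n : ℕ) (hq : q ≠ 0)
    (hs : ((a - b - c) * s - 1) * q = -(b * c))
    (hu : poch (1 + a - b) n ≠ 0) (hv : poch (1 + a - c) n ≠ 0) :
    ∑ j ∈ range (n + 1), (-1) ^ j * (n.choose j : ℂ) * poch (a + n) j
        * (poch (a - b - c) j * (1 + s * j) / (poch (1 + a - b) j * poch (1 + a - c) j))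
      = poch b n * poch c n / (poch (1 + a - b) n * poch (1 + a - c) n)
        * (1 + n * (a + n) / q) := by
  have hs' : (a - b - c) * s - 1 = -(b * c) / q := by rw [← hs]; field_simp
  cases n with
  | zero => simp [poch_zero]
  | succ n =>
    have h1 := sum_saalschuetz a b c (n + 1) hu hv
    rw [poch_succ'] at hu hv
    have hu0 := left_ne_zero_of_mul hu
    have hv0 := left_ne_zero_of_mul hv
    have hun := right_ne_zero_of_mul hu
    have hvn := right_ne_zero_of_mul hv
    have eu : 1 + (a + 2) - (b + 1) = 1 + a - b + 1 := by ring
    have ev : 1 + (a + 2) - (c + 1) = 1 + a - c + 1 := by ring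
    have ed : 1 + (a + 2) - (b + 1) - (c + 1) = 1 + a - b - c := by ring
    have h2 := sum_saalschuetz (a + 2) (b + 1) (c + 1) n (by rwa [eu]) (by rwa [ev])
    rw [ed, eu, ev] at h2
    have key : ∑ j ∈ range (n + 1 + 1), (-1) ^ j * ((n + 1).choose j : ℂ)
          * poch (a + (n + 1 : ℕ)) j
          * (poch (a - b - c) j * (1 + s * j) / (poch (1 + a - b) j * poch (1 + a - c) j))
        = ∑ j ∈ range (n + 1 + 1), (-1) ^ j * ((n + 1).choose j : ℂ)
            * poch (a + (n + 1 : ℕ)) j * poch (1 + a - b - c) j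
            / (poch (1 + a - b) j * poch (1 + a - c) j)
          + -(((a - b - c) * s - 1) * (n + 1) * (a + n + 1) / ((1 + a - b) * (1 + a - c)))
            * ∑ j ∈ range (n + 1), (-1) ^ j * (n.choose j : ℂ) * poch (a + 2 + n) j
              * poch (1 + a - b - c) j / (poch (1 + a - b + 1) j * poch (1 + a - c + 1) j) := by
      rw [sum_range_succ', sum_range_succ' _ (n + 1), mul_sum, add_right_comm,
        ← sum_add_distrib]
      congr 1
      · refine sum_congr rfl fun j hj => ?_
        have hjn : j ≤ n := Nat.lt_succ_iff.mp (mem_range.mp hj)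
        have hj1 := poch_ne_zero_of_le hjn hun
        have hj2 := poch_ne_zero_of_le hjn hvn
        have hj' : (j : ℂ) + 1 ≠ 0 := Nat.cast_add_one_ne_zero j
        have hc : ((n + 1).choose (j + 1) : ℂ) = (n + 1) * n.choose j / (j + 1) := by
          rw [eq_div_iff hj']
          exact_mod_cast (Nat.add_one_mul_choose_eq n j).symm
        rw [poch_succ' (a - b - c), poch_succ' (1 + a - b) j, poch_succ' (1 + a - c) j,
          poch_succ (1 + a - b - c), poch_succ' (a + (n + 1 : ℕ)), hc]
        push_cast
        rw [show a - b - c + 1 = 1 + a - b - c by ring,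
          show a + ((n : ℂ) + 1) + 1 = a + 2 + n by ring]
        field_simp
        ring
      · simp [poch_zero]
    rw [key, h1, h2, hs']
    simp only [poch_succ']
    push_cast
    field_simp
    ring

theorem sum_choose_mul_choose_poch (a w : ℂ) (n j : ℕ) (hj : j ≤ n) (hw : poch w n ≠ 0)
    (hd : poch (1 + a - w - n) (2 * j) ≠ 0) :
    ∑ k ∈ range (n + 1), (-1) ^ (k + j) * (n.choose k : ℂ) * k.choose j * poch a (k + j) / poch w k
      = (-1) ^ j * (n.choose j : ℂ) * (poch (w - a) n / poch w n)
        * (poch (1 + a - w) j * poch a (2 * j) / poch (1 + a - w - n) (2 * j)) := by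
  obtain ⟨N, rfl⟩ := Nat.exists_eq_add_of_le hj
  have hlow : ∑ k ∈ range j, (-1) ^ (k + j) * ((j + N).choose k : ℂ) * k.choose j
      * poch a (k + j) / poch w k = 0 :=
    sum_eq_zero fun k hk => by simp [Nat.choose_eq_zero_of_lt (mem_range.mp hk)]
  have hterm : ∀ i ∈ range (N + 1), (-1) ^ (j + i + j) * ((j + N).choose (j + i) : ℂ)
      * (j + i).choose j * poch a (j + i + j) / poch w (j + i)
      = (j + N).choose j * poch a (2 * j) / poch w j
        * ((-1) ^ i * (N.choose i : ℂ) * poch (a + 2 * j) i / poch (w + j) i) := by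
    intro i hi
    have hiN : i ≤ N := Nat.lt_succ_iff.mp (mem_range.mp hi)
    have hc : ((j + N).choose (j + i) : ℂ) * (j + i).choose j
        = (j + N).choose j * N.choose i := by
      have := Nat.choose_mul (n := j + N) (k := j + i) (s := j) (by omega)
      simp only [Nat.add_sub_cancel_left] at this
      exact_mod_cast this
    have hsign : (-1 : ℂ) ^ (j + i + j) = (-1) ^ i := by
      rw [show j + i + j = 2 * j + i by ring, pow_add, pow_mul]; simp
    rw [hsign, show j + i + j = 2 * j + i by ring, poch_add a, poch_add w, mul_assoc ((-1) ^ i), hc]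
    push_cast
    ring
  have hw' := hw
  rw [poch_add] at hw'
  have hwj := left_ne_zero_of_mul hw'
  have hwN := right_ne_zero_of_mul hw'
  have hrefl : poch (w - a - j) N * poch (1 + a - w - (j + N : ℕ)) (2 * j)
      = (-1) ^ j * poch (1 + a - w) j * poch (w - a) (j + N) := by
    have h1 := poch_add (w - a - j) N (2 * j)
    have h2 := poch_add (w - a - j) j (j + N)
    have h3 := poch_reflect (w - a) j
    have h4 := poch_reflect (1 + a - w - N + j) (2 * j)
    rw [show 1 - (w - a) = 1 + a - w by ring] at h3
    rw [pow_mul, show 1 - (1 + a - w - N + j) = w - a - j + N by ring,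
      show 1 + a - w - N + j - ((2 * j : ℕ) : ℂ) = 1 + a - w - (j + N : ℕ) by push_cast; ring]
      at h4
    rw [show j + (j + N) = N + 2 * j by ring, sub_add_cancel, h1, h3] at h2
    rw [h4]
    simpa using h2
  rw [add_assoc, sum_range_add, hlow, zero_add, sum_congr rfl hterm, ← mul_sum,
    sum_choose_poch_div _ _ _ hwN, show w + j - (a + 2 * j) = w - a - j by ring, poch_add w j N]
  field_simp
  linear_combination ((j + N).choose j : ℂ) * poch a (2 * j) * hrefl

theorem corollary_1C3P16 (n : ℕ) (a b c p w : ℂ)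
    (hbc : b * c - p * (a - p) ≠ 0) (γ : ℂ)
    (hγ : γ = p * (a - p) * (b + c - a) / (b * c - p * (a - p)))
    (hnd : ∀ z ∈ [1 + a - b, 1 + a - c, p, a - p, w,
        (1 + a - w - (n : ℂ)) / 2, (2 + a - w - (n : ℂ)) / 2, γ],
      ∀ k ≤ n, poch z k ≠ 0) :
    hypTerm [a, b, c, a - p + 1, p + 1] [1 + a - b, 1 + a - c, p, a - p, w] n 1
      = poch (w - a) n / poch w n *
        hypTerm [1 + a - w, a / 2, (a + 1) / 2, a - b - c, γ + 1]
          [1 + a - b, 1 + a - c, (1 + a - w - (n : ℂ)) / 2, (2 + a - w - (n : ℂ)) / 2, γ]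
          n 1 := by
  have hden : ∀ j ≤ n, poch (1 + a - w - n) (2 * j) ≠ 0 := by
    intro j hj
    rw [poch_two_mul, show 1 + a - w - (n : ℂ) + 1 = 2 + a - w - n by ring]
    exact mul_ne_zero (pow_ne_zero _ (by norm_num))
      (mul_ne_zero (hnd _ (by simp) j hj) (hnd _ (by simp) j hj))
  have hu : ∀ k ≤ n, poch (1 + a - b) k ≠ 0 := hnd _ (by simp)
  have hv : ∀ k ≤ n, poch (1 + a - c) k ≠ 0 := hnd _ (by simp)
  have hw : ∀ k ≤ n, poch w k ≠ 0 := hnd _ (by simp)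
  rcases Nat.eq_zero_or_pos n with rfl | hn
  · simp [hypTerm, poch_zero]
  have hp0 : p ≠ 0 := by simpa [poch_succ, poch_zero] using hnd p (by simp) 1 hn
  have hap0 : a - p ≠ 0 := by simpa [poch_succ, poch_zero] using hnd (a - p) (by simp) 1 hn
  have hγ0 : γ ≠ 0 := by simpa [poch_succ, poch_zero] using hnd γ (by simp) 1 hn
  have hs : ((a - b - c) * γ⁻¹ - 1) * (p * (a - p)) = -(b * c) := by
    have hγ' : γ * (b * c - p * (a - p)) = p * (a - p) * (b + c - a) := by
      rw [hγ, div_mul_cancel₀ _ hbc]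
    field_simp
    linear_combination hγ'
  have hratio : ∀ z ≠ 0, ∀ k, poch (z + 1) k = poch z k * (z + k) / z := by
    intro z hz k
    rw [eq_div_iff hz, ← poch_succ, poch_succ', mul_comm]
  set q : ℕ → ℂ := fun j =>
    poch (a - b - c) j * (1 + γ⁻¹ * j) / (poch (1 + a - b) j * poch (1 + a - c) j) with hq
  have hleft : hypTerm [a, b, c, a - p + 1, p + 1] [1 + a - b, 1 + a - c, p, a - p, w] n 1
      = ∑ k ∈ range (n + 1), ∑ j ∈ range (n + 1),
        (-1) ^ (k + j) * (n.choose k : ℂ) * k.choose j * poch a (k + j) / poch w k * q j := by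
    refine sum_congr rfl fun k hk => ?_
    have hk : k ≤ n := Nat.lt_succ_iff.mp (mem_range.mp hk)
    have hsub : ∑ j ∈ range (n + 1),
        (-1) ^ (k + j) * (n.choose k : ℂ) * k.choose j * poch a (k + j) / poch w k * q j
        = (-1) ^ k * n.choose k * poch a k / poch w k
          * ∑ j ∈ range (k + 1), (-1) ^ j * (k.choose j : ℂ) * poch (a + k) j * q j := by
      rw [mul_sum]
      refine (sum_subset_zero_on_sdiff (range_mono (by omega)) ?_ ?_).symm
      · intro j hj
        rw [mem_sdiff, mem_range, mem_range] at hj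
        simp [Nat.choose_eq_zero_of_lt (show k < j by omega)]
      · intro j _
        rw [poch_add a k j, pow_add]
        ring
    rw [hsub, hq, sum_saalschuetz_linear a b c γ⁻¹ (p * (a - p)) k (mul_ne_zero hp0 hap0) hs
      (hu k hk) (hv k hk)]
    simp only [List.map_cons, List.map_nil, List.prod_cons, List.prod_nil, poch_neg_natCast,
      hratio p hp0, hratio (a - p) hap0]
    have := hu k hk
    have := hv k hk
    have := hw k hk
    have := hnd p (by simp) k hk
    have := hnd (a - p) (by simp) k hk
    have : (k.factorial : ℂ) ≠ 0 := Nat.cast_ne_zero.mpr k.factorial_ne_zero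
    field_simp
    ring
  rw [hleft, sum_comm, hypTerm, mul_sum]
  refine sum_congr rfl fun j hj => ?_
  have hj : j ≤ n := Nat.lt_succ_iff.mp (mem_range.mp hj)
  rw [← sum_mul, sum_choose_mul_choose_poch a w n j hj (hw n le_rfl) (hden j hj)]
  simp only [List.map_cons, List.map_nil, List.prod_cons, List.prod_nil, poch_neg_natCast,
    hratio γ hγ0, hq, poch_two_mul, show 1 + a - w - (n : ℂ) + 1 = 2 + a - w - n by ring]
  have := hu j hj
  have := hv j hj
  have := hw n le_rfl
  have := hnd γ (by simp) j hj
  have := hnd ((1 + a - w - (n : ℂ)) / 2) (by simp) j hj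
  have := hnd ((2 + a - w - (n : ℂ)) / 2) (by simp) j hj
  have : (j.factorial : ℂ) ≠ 0 := Nat.cast_ne_zero.mpr j.factorial_ne_zero
  field_simp
  ring
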